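/- Set γ = (1+√2)². There exist constants C₁, C₂ > 0 such that for all N ∈ ℕ, all M ∈ ℕ with M ≥ C₁ N² γ^N, and all 0 ≤ δ ≤ 2/M, the N×N matrix Ĥ_N^{(M)} with entries (Ĥ_N^{(M)})_{kℓ} = (1/M)∑_{m=0}^{M−1} x_m^{k+ℓ} built from the nodes x_m = −1 + δ + 2m/M is invertible and satisfies ‖(Ĥ_N^{(M)})^{−1}‖₂ ≤ C₂ γ^N. -/

import Mathlib

open Polynomial in
/-- The absolute coefficient sum of the Chebyshev polynomial `U n` is at most `(1 + √2) ^ n`. -/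
lemma sum_abs_coeff_U_le (N n : ℕ) :
    ∑ k ∈ Finset.range N, |(Chebyshev.U ℝ n).coeff k| ≤ (1 + Real.sqrt 2) ^ n := by
  have hX : ∀ p : ℝ[X], ∑ k ∈ Finset.range N, |(X * p).coeff k| ≤
      ∑ k ∈ Finset.range N, |p.coeff k| := by
    intro p
    cases N with
    | zero => simp
    | succ N =>
      rw [Finset.sum_range_succ', Finset.sum_range_succ]
      simp only [coeff_X_mul, coeff_X_mul_zero, abs_zero]
      gcongr
      exact abs_nonneg _
  have hs : Real.sqrt 2 ^ 2 = 2 := Real.sq_sqrt (by norm_num)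
  have hs1 : 1 ≤ Real.sqrt 2 := by rw [Real.one_le_sqrt]; norm_num
  have hone : ∑ k ∈ Finset.range N, |(1 : ℝ[X]).coeff k| ≤ 1 := by
    simp only [coeff_one]
    calc ∑ k ∈ Finset.range N, |if k = 0 then (1 : ℝ) else 0|
        = ∑ k ∈ Finset.range N, if k = 0 then (1 : ℝ) else 0 := by
          refine Finset.sum_congr rfl fun k _ => ?_
          split_ifs <;> simp
      _ ≤ 1 := by
          rw [Finset.sum_ite_eq']
          split_ifs <;> norm_num
  have hrec : ∀ p q : ℝ[X], ∑ k ∈ Finset.range N, |(2 * X * p - q).coeff k| ≤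
      2 * ∑ k ∈ Finset.range N, |p.coeff k| + ∑ k ∈ Finset.range N, |q.coeff k| := by
    intro p q
    refine le_trans ?_ (add_le_add_left (mul_le_mul_of_nonneg_left (hX p) zero_le_two) _)
    rw [Finset.mul_sum, ← Finset.sum_add_distrib]
    refine Finset.sum_le_sum fun k _ => ?_
    have h2 : (2 * X * p).coeff k = 2 * (X * p).coeff k := by
      rw [mul_assoc, coeff_ofNat_mul]
    rw [coeff_sub, h2]
    refine (abs_sub _ _).trans ?_
    rw [abs_mul, abs_two]
  induction n using Nat.twoStepInduction with
  | zero => simpa using hone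
  | one =>
    have h := hrec 1 0
    have h1 : Chebyshev.U ℝ ((1 : ℕ) : ℤ) = 2 * X * 1 - 0 := by simp
    rw [h1]
    refine h.trans ?_
    simp only [coeff_zero, abs_zero, Finset.sum_const_zero, pow_one]
    linarith
  | more n ih0 ih1 =>
    have h1 : Chebyshev.U ℝ ((n + 2 : ℕ) : ℤ) =
        2 * X * Chebyshev.U ℝ ((n + 1 : ℕ) : ℤ) - Chebyshev.U ℝ (n : ℤ) := by
      push_cast
      exact Chebyshev.U_add_two ℝ n
    rw [h1]
    refine (hrec _ _).trans ?_
    calc _ ≤ 2 * (1 + Real.sqrt 2) ^ (n + 1) + (1 + Real.sqrt 2) ^ n := by gcongr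
      _ = (1 + Real.sqrt 2) ^ n * (3 + 2 * Real.sqrt 2) := by ring
      _ = (1 + Real.sqrt 2) ^ n * (1 + 2 * Real.sqrt 2 + Real.sqrt 2 ^ 2) := by rw [hs]; ring
      _ = (1 + Real.sqrt 2) ^ (n + 2) := by ring

open Polynomial in
lemma exists_eq_sum_C_mul_U (N : ℕ) (p : ℝ[X]) (hp : p.degree < N) :
    ∃ c : ℕ → ℝ, p = ∑ n ∈ Finset.range N, C (c n) * Chebyshev.U ℝ n := by
  induction N generalizing p with
  | zero =>
    refine ⟨0, ?_⟩
    rw [degree_lt_iff_coeff_zero] at hp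
    ext k
    simp [hp k (Nat.zero_le k)]
  | succ N ih =>
    have hl : (Chebyshev.U ℝ N).coeff N = 2 ^ N := by
      have h := Chebyshev.leadingCoeff_U_natCast ℝ N
      rwa [leadingCoeff, Chebyshev.natDegree_U_natCast] at h
    rw [degree_lt_iff_coeff_zero] at hp
    obtain ⟨c, hc⟩ := ih (p - C (p.coeff N / 2 ^ N) * Chebyshev.U ℝ N) (by
      rw [degree_lt_iff_coeff_zero]
      intro m hm
      rw [coeff_sub, coeff_C_mul]
      rcases hm.eq_or_lt with rfl | hm
      · rw [hl]
        field_simp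
        ring
      · rw [hp m hm, coeff_eq_zero_of_natDegree_lt
          (p := Chebyshev.U ℝ N) (by rwa [Chebyshev.natDegree_U_natCast])]
        ring)
    refine ⟨fun n => if n = N then p.coeff N / 2 ^ N else c n, ?_⟩
    simp only [Finset.sum_range_succ, if_true]
    rw [← sub_eq_iff_eq_add, hc]
    refine Finset.sum_congr rfl fun n hn => ?_
    rw [if_neg (Finset.mem_range.mp hn).ne]

open Real in
lemma integral_cos_int_mul (k : ℤ) :
    ∫ θ in (0 : ℝ)..π, cos (k * θ) = if k = 0 then π else 0 := by
  split_ifs with h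
  · simp [h]
  · have hk : (k : ℝ) ≠ 0 := by exact_mod_cast h
    rw [intervalIntegral.integral_comp_mul_left (fun x => cos x) hk]
    simp [sin_int_mul_pi]

open Real in
lemma integral_sin_mul_sin_nat (m n : ℕ) :
    ∫ θ in (0 : ℝ)..π, sin ((m + 1) * θ) * sin ((n + 1) * θ) = if m = n then π / 2 else 0 := by
  have h : ∀ θ : ℝ, sin ((m + 1) * θ) * sin ((n + 1) * θ) =
      (cos (((m - n : ℤ) : ℝ) * θ) - cos (((m + n + 2 : ℤ) : ℝ) * θ)) / 2 := by
    intro θ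
    have e1 : ((m - n : ℤ) : ℝ) * θ = (m + 1) * θ - (n + 1) * θ := by push_cast; ring
    have e2 : ((m + n + 2 : ℤ) : ℝ) * θ = (m + 1) * θ + (n + 1) * θ := by push_cast; ring
    rw [e1, e2, cos_sub, cos_add]
    ring
  simp_rw [h]
  rw [intervalIntegral.integral_div, intervalIntegral.integral_sub
    ((by fun_prop : Continuous _).intervalIntegrable _ _)
    ((by fun_prop : Continuous _).intervalIntegrable _ _), integral_cos_int_mul,
    integral_cos_int_mul, if_neg (by omega : ¬ (m + n + 2 : ℤ) = 0)]
  by_cases hmn : m = n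
  · simp [hmn]
  · rw [if_neg (by omega), if_neg hmn]
    simp

open Real in
lemma integral_sum_mul_sin_sq (N : ℕ) (c : ℕ → ℝ) :
    ∫ θ in (0 : ℝ)..π, (∑ n ∈ Finset.range N, c n * sin ((n + 1) * θ)) ^ 2 =
      π / 2 * ∑ n ∈ Finset.range N, c n ^ 2 := by
  have h : ∀ θ : ℝ, (∑ n ∈ Finset.range N, c n * sin ((n + 1) * θ)) ^ 2 =
      ∑ m ∈ Finset.range N, ∑ n ∈ Finset.range N,
        c m * c n * (sin ((m + 1) * θ) * sin ((n + 1) * θ)) := by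
    intro θ
    rw [sq, Finset.sum_mul_sum]
    refine Finset.sum_congr rfl fun m _ => Finset.sum_congr rfl fun n _ => ?_
    ring
  simp_rw [h]
  rw [intervalIntegral.integral_finsetSum
    fun m _ => (by fun_prop : Continuous _).intervalIntegrable _ _, Finset.mul_sum]
  refine Finset.sum_congr rfl fun m hm => ?_
  rw [intervalIntegral.integral_finsetSum
    fun n _ => (by fun_prop : Continuous _).intervalIntegrable _ _]
  simp_rw [intervalIntegral.integral_const_mul, integral_sin_mul_sin_nat]
  simp only [mul_ite, mul_zero]
  rw [Finset.sum_ite_eq, if_pos hm]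
  ring

open Polynomial Real in
lemma integral_sq_mul_sin_sq_le (p : ℝ[X]) :
    ∫ θ in (0 : ℝ)..π, (p.eval (cos θ) * sin θ) ^ 2 ≤ ∫ x in (-1 : ℝ)..1, p.eval x ^ 2 := by
  have hsub := intervalIntegral.integral_comp_mul_deriv (a := π) (b := 0) (f := cos)
    (f' := fun θ => -sin θ) (g := fun x => p.eval x ^ 2)
    (fun x _ => hasDerivAt_cos x) (by fun_prop) (by fun_prop)
  rw [cos_pi, cos_zero] at hsub
  rw [← hsub, intervalIntegral.integral_symm 0 π, ← intervalIntegral.integral_neg]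
  refine intervalIntegral.integral_mono_on pi_pos.le
    ((by fun_prop : Continuous _).intervalIntegrable _ _)
    ((by fun_prop : Continuous _).intervalIntegrable _ _) fun θ hθ => ?_
  have h0 := sin_nonneg_of_mem_Icc hθ
  have h1 := sin_le_one θ
  have h2 : sin θ ^ 2 ≤ sin θ := by nlinarith
  have h3 := mul_le_mul_of_nonneg_left h2 (sq_nonneg (p.eval (cos θ)))
  simp only [Function.comp]
  nlinarith

open Polynomial Real in
/-- The sum of squared coefficients of a polynomial of degree less than `N` is controlled by its
`L²` norm on `[-1, 1]`, with exponential rate `(1 + √2) ^ 2`. -/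
lemma sum_sq_coeff_le_integral (N : ℕ) (p : ℝ[X]) (hp : p.degree < N) :
    π / 2 * ∑ k ∈ Finset.range N, p.coeff k ^ 2 ≤
      ((1 + √2) ^ 2) ^ N * ∫ x in (-1 : ℝ)..1, p.eval x ^ 2 := by
  obtain ⟨c, hc⟩ := exists_eq_sum_C_mul_U N p hp
  have hint : π / 2 * ∑ n ∈ Finset.range N, c n ^ 2 ≤ ∫ x in (-1 : ℝ)..1, p.eval x ^ 2 := by
    rw [← integral_sum_mul_sin_sq]
    refine le_trans (le_of_eq ?_) (integral_sq_mul_sin_sq_le p)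
    congr 1
    ext θ
    congr 1
    rw [hc, eval_finsetSum, Finset.sum_mul]
    refine Finset.sum_congr rfl fun n _ => ?_
    rw [eval_mul, eval_C, mul_assoc, Chebyshev.U_real_cos]
    push_cast
    rfl
  have habs : ∑ k ∈ Finset.range N, |p.coeff k| ≤
      ∑ n ∈ Finset.range N, |c n| * (1 + √2) ^ n := by
    calc ∑ k ∈ Finset.range N, |p.coeff k|
        ≤ ∑ k ∈ Finset.range N, ∑ n ∈ Finset.range N,
            |c n| * |(Chebyshev.U ℝ n).coeff k| := by
          refine Finset.sum_le_sum fun k _ => ?_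
          conv_lhs => rw [hc, finsetSum_coeff]
          refine (Finset.abs_sum_le_sum_abs _ _).trans (le_of_eq ?_)
          simp [abs_mul]
      _ = ∑ n ∈ Finset.range N, |c n| *
            ∑ k ∈ Finset.range N, |(Chebyshev.U ℝ n).coeff k| := by
          rw [Finset.sum_comm]
          simp_rw [Finset.mul_sum]
      _ ≤ _ := by
          gcongr
          exact sum_abs_coeff_U_le N _
  have hsq : ∑ k ∈ Finset.range N, p.coeff k ^ 2 ≤ (∑ k ∈ Finset.range N, |p.coeff k|) ^ 2 := by
    simp_rw [← sq_abs (p.coeff _)]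
    exact Finset.sum_sq_le_sq_sum_of_nonneg fun _ _ => abs_nonneg _
  have hgeom : ∑ n ∈ Finset.range N, ((1 + √2) ^ n) ^ 2 ≤ ((1 + √2) ^ 2) ^ N := by
    have hs : 1 ≤ √2 := by rw [Real.one_le_sqrt]; norm_num
    clear hint habs hsq hc hp
    induction N with
    | zero => simp
    | succ N ih =>
      rw [Finset.sum_range_succ, pow_right_comm (1 + √2) N 2, pow_succ _ N]
      have : 0 ≤ ((1 + √2) ^ 2) ^ N := by positivity
      nlinarith [mul_nonneg this (by nlinarith : 0 ≤ (1 + √2) ^ 2 - 2)]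
  have hCS := Finset.sum_mul_sq_le_sq_mul_sq (Finset.range N) (fun n => |c n|)
    (fun n => (1 + √2) ^ n)
  simp only [sq_abs] at hCS
  have hfin : ∑ k ∈ Finset.range N, p.coeff k ^ 2 ≤
      (∑ n ∈ Finset.range N, c n ^ 2) * ((1 + √2) ^ 2) ^ N :=
    hsq.trans ((pow_le_pow_left₀ (by positivity) habs 2).trans (hCS.trans (by gcongr)))
  calc π / 2 * ∑ k ∈ Finset.range N, p.coeff k ^ 2
      ≤ π / 2 * ((∑ n ∈ Finset.range N, c n ^ 2) * ((1 + √2) ^ 2) ^ N) := by gcongr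
    _ = ((1 + √2) ^ 2) ^ N * (π / 2 * ∑ n ∈ Finset.range N, c n ^ 2) := by ring
    _ ≤ _ := by gcongr

/-- Error of the equidistant Riemann sum for a monomial on `[-1, 1]`. -/
lemma abs_riemann_sum_pow_sub_integral_le (M j : ℕ) (hM : 0 < M) (δ : ℝ) (h0 : 0 ≤ δ)
    (h1 : δ ≤ 2 / M) :
    |1 / M * ∑ m ∈ Finset.range M, (-1 + δ + 2 * m / M) ^ j -
      1 / 2 * ∫ x in (-1 : ℝ)..1, x ^ j| ≤ 2 * j / M := by
  have hM' : (0 : ℝ) < M := by exact_mod_cast hM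
  let a : ℕ → ℝ := fun m => -1 + 2 * m / M
  have ha0 : a 0 = -1 := by simp [a]
  have haM : a M = 1 := by simp only [a]; field_simp; norm_num
  have hstep : ∀ m, a (m + 1) = a m + 2 / M := by
    intro m; simp only [a]; push_cast; ring
  have hlow : ∀ m, -1 ≤ a m := by
    intro m
    have : (0 : ℝ) ≤ 2 * m / M := by positivity
    simp only [a]; linarith
  have hup : ∀ m < M, a (m + 1) ≤ 1 := by
    intro m hm
    have h : ((m + 1 : ℕ) : ℝ) ≤ M := by exact_mod_cast hm
    have : 2 * ((m + 1 : ℕ) : ℝ) / M ≤ 2 := by rw [div_le_iff₀ hM']; linarith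
    simp only [a]; linarith
  have hsum : ∑ m ∈ Finset.range M, ∫ x in a m..a (m + 1), x ^ j = ∫ x in (-1 : ℝ)..1, x ^ j := by
    rw [intervalIntegral.sum_integral_adjacent_intervals
      fun m _ => (by fun_prop : Continuous _).intervalIntegrable _ _, ha0, haM]
  have hcell : ∀ m ∈ Finset.range M,
      |2 / M * (-1 + δ + 2 * m / M) ^ j - ∫ x in a m..a (m + 1), x ^ j| ≤
        j * (2 / M) * (2 / M) := by
    intro m hm
    have hm' := Finset.mem_range.mp hm
    have h2M : (0 : ℝ) ≤ 2 / M := by positivity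
    have hx : -1 + δ + 2 * m / M = a m + δ := by simp only [a]; ring
    have hd : a (m + 1) - a m = 2 / M := by rw [hstep]; ring
    have hc : 2 / M * (a m + δ) ^ j = ∫ _ in a m..a (m + 1), (a m + δ) ^ j := by
      rw [intervalIntegral.integral_const, smul_eq_mul, hd]
    rw [hx, hc, ← intervalIntegral.integral_sub
      ((by fun_prop : Continuous _).intervalIntegrable _ _)
      ((by fun_prop : Continuous _).intervalIntegrable _ _), ← Real.norm_eq_abs]
    refine (intervalIntegral.norm_integral_le_of_norm_le_const (C := j * (2 / M))
      fun x hx => ?_).trans (le_of_eq ?_)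
    · rw [Set.uIoc_of_le (by linarith), Set.mem_Ioc] at hx
      have l1 := hlow m
      have l2 := hup m hm'
      have l3 := hstep m
      rw [Real.norm_eq_abs]
      refine (abs_pow_sub_pow_le _ _ _).trans ?_
      have e1 : |a m + δ - x| ≤ 2 / M := abs_le.mpr ⟨by linarith, by linarith⟩
      have e2 : max |a m + δ| |x| ≤ 1 :=
        max_le (abs_le.mpr ⟨by linarith, by linarith⟩) (abs_le.mpr ⟨by linarith, by linarith⟩)
      have e3 : max |a m + δ| |x| ^ (j - 1) ≤ 1 :=
        pow_le_one₀ (le_max_of_le_left (abs_nonneg _)) e2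
      calc |a m + δ - x| * j * max |a m + δ| |x| ^ (j - 1) ≤ 2 / M * j * 1 := by gcongr
        _ = j * (2 / M) := by ring
    · rw [hd, abs_of_nonneg h2M]
  have heq : 1 / M * ∑ m ∈ Finset.range M, (-1 + δ + 2 * m / M) ^ j -
      1 / 2 * ∫ x in (-1 : ℝ)..1, x ^ j = 1 / 2 * ∑ m ∈ Finset.range M,
        (2 / M * (-1 + δ + 2 * m / M) ^ j - ∫ x in a m..a (m + 1), x ^ j) := by
    rw [Finset.sum_sub_distrib, hsum, ← Finset.mul_sum]
    ring
  rw [heq, abs_mul, abs_of_pos (by norm_num : (0 : ℝ) < 1 / 2)]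
  calc 1 / 2 * |∑ m ∈ Finset.range M,
        (2 / M * (-1 + δ + 2 * m / M) ^ j - ∫ x in a m..a (m + 1), x ^ j)|
      ≤ 1 / 2 * ∑ m ∈ Finset.range M, (j * (2 / M) * (2 / M) : ℝ) := by
        gcongr
        exact (Finset.abs_sum_le_sum_abs _ _).trans (Finset.sum_le_sum hcell)
    _ = 2 * j / M := by
        rw [Finset.sum_const, Finset.card_range, nsmul_eq_mul]
        field_simp

lemma sum_mul_mul_integral_pow_eq {N : ℕ} (v : Fin N → ℝ) :
    ∑ k, ∑ l, v k * v l * (1 / 2 * ∫ x in (-1 : ℝ)..1, x ^ ((k : ℕ) + (l : ℕ))) =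
      1 / 2 * ∫ x in (-1 : ℝ)..1, (∑ k, v k * x ^ (k : ℕ)) ^ 2 := by
  have h : ∀ x : ℝ, (∑ k, v k * x ^ (k : ℕ)) ^ 2 =
      ∑ k, ∑ l, v k * v l * x ^ ((k : ℕ) + (l : ℕ)) := by
    intro x
    rw [sq, Finset.sum_mul_sum]
    refine Finset.sum_congr rfl fun k _ => Finset.sum_congr rfl fun l _ => ?_
    ring
  simp_rw [h]
  rw [intervalIntegral.integral_finsetSum
    fun m _ => (by fun_prop : Continuous _).intervalIntegrable _ _, Finset.mul_sum]
  refine Finset.sum_congr rfl fun k _ => ?_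
  rw [intervalIntegral.integral_finsetSum
    fun m _ => (by fun_prop : Continuous _).intervalIntegrable _ _, Finset.mul_sum]
  refine Finset.sum_congr rfl fun l _ => ?_
  rw [intervalIntegral.integral_const_mul]
  ring

open Polynomial Real in
/-- Lower bound for the quadratic form of the Gram matrix of the monomials on `[-1, 1]`. -/
lemma pi_div_four_mul_sum_sq_le {N : ℕ} (v : Fin N → ℝ) :
    π / 4 * ∑ k, v k ^ 2 ≤ ((1 + √2) ^ 2) ^ N *
      ∑ k, ∑ l, v k * v l * (1 / 2 * ∫ x in (-1 : ℝ)..1, x ^ ((k : ℕ) + (l : ℕ))) := by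
  have h := sum_sq_coeff_le_integral N (∑ k : Fin N, C (v k) * X ^ (k : ℕ))
    (degree_sum_fin_lt v)
  have hcoeff : ∀ k : Fin N, (∑ k : Fin N, C (v k) * X ^ (k : ℕ)).coeff k = v k := by
    intro k
    simp [coeff_X_pow, Fin.val_inj]
  rw [Finset.sum_range] at h
  simp_rw [hcoeff, eval_finsetSum, eval_mul, eval_C, eval_pow, eval_X] at h
  rw [sum_mul_mul_integral_pow_eq]
  linarith

/-- A real matrix whose quadratic form is bounded below by `c > 0` is invertible, and its inverse
has norm at most `c⁻¹`. -/
lemma isUnit_and_norm_inv_le_of_coercive {n : Type*} [Fintype n] [DecidableEq n]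
    (A : Matrix n n ℝ) (c : ℝ) (hc : 0 < c)
    (h : ∀ v : n → ℝ, c * ∑ k, v k ^ 2 ≤ ∑ k, ∑ l, v k * v l * A k l) :
    IsUnit A ∧ ∀ v : EuclideanSpace ℝ n, ‖Matrix.toEuclideanLin A⁻¹ v‖ ≤ c⁻¹ * ‖v‖ := by
  have hco : ∀ v : EuclideanSpace ℝ n, c * ‖v‖ ≤ ‖Matrix.toEuclideanLin A v‖ := by
    intro v
    have h1 := h v.ofLp
    have h2 : ∑ k, ∑ l, v k * v l * A k l = inner ℝ (Matrix.toEuclideanLin A v) v := by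
      rw [PiLp.inner_apply]
      refine Finset.sum_congr rfl fun k _ => ?_
      rw [Matrix.ofLp_toLpLin, Matrix.toLin'_apply]
      simp only [RCLike.inner_apply, conj_trivial, Matrix.mulVec, dotProduct, Finset.mul_sum]
      refine Finset.sum_congr rfl fun l _ => ?_
      ring
    rw [h2, ← EuclideanSpace.real_norm_sq_eq] at h1
    have h3 := h1.trans (real_inner_le_norm _ _)
    rcases (norm_nonneg v).eq_or_lt with h0 | h0
    · rw [← h0, mul_zero]; exact norm_nonneg _
    · refine le_of_mul_le_mul_right ?_ h0
      linarith
  have hu : IsUnit A := by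
    rw [← Matrix.mulVec_injective_iff_isUnit]
    intro x y hxy
    have h1 := hco (WithLp.toLp 2 (x - y))
    have h2 : Matrix.toEuclideanLin A (WithLp.toLp 2 (x - y)) = 0 := by
      rw [Matrix.toLpLin_toLp, Matrix.toLin'_apply, Matrix.mulVec_sub, sub_eq_zero.mpr hxy]
      rfl
    rw [h2, norm_zero] at h1
    have h3 : ‖WithLp.toLp 2 (x - y)‖ = 0 := by nlinarith [norm_nonneg (WithLp.toLp 2 (x - y))]
    rw [norm_eq_zero, WithLp.toLp_eq_zero] at h3
    exact sub_eq_zero.mp h3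
  refine ⟨hu, fun v => ?_⟩
  have h1 := hco (Matrix.toEuclideanLin A⁻¹ v)
  have h2 : Matrix.toEuclideanLin A (Matrix.toEuclideanLin A⁻¹ v) = v := by
    ext i
    simp only [Matrix.ofLp_toLpLin, Matrix.toLin'_apply, Matrix.mulVec_mulVec]
    rw [Matrix.mul_nonsing_inv A ((Matrix.isUnit_iff_isUnit_det A).mp hu), Matrix.one_mulVec]
  rw [h2] at h1
  rwa [inv_mul_eq_div, le_div_iff₀ hc, mul_comm]

lemma abs_sum_mul_mul_le {n : Type*} [Fintype n] (v : n → ℝ) (E : n → n → ℝ) (ε : ℝ)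
    (hE : ∀ k l, |E k l| ≤ ε) (hε : 0 ≤ ε) :
    |∑ k, ∑ l, v k * v l * E k l| ≤ ε * (Fintype.card n * ∑ k, v k ^ 2) := by
  calc |∑ k, ∑ l, v k * v l * E k l| ≤ ∑ k, ∑ l, |v k| * |v l| * ε := by
        refine (Finset.abs_sum_le_sum_abs _ _).trans (Finset.sum_le_sum fun k _ => ?_)
        refine (Finset.abs_sum_le_sum_abs _ _).trans (Finset.sum_le_sum fun l _ => ?_)
        rw [abs_mul, abs_mul]
        gcongr
        exact hE k l
    _ = ε * (∑ k, |v k|) ^ 2 := by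
        rw [sq, Finset.sum_mul_sum, Finset.mul_sum]
        refine Finset.sum_congr rfl fun k _ => ?_
        rw [Finset.mul_sum]
        exact Finset.sum_congr rfl fun l _ => by ring
    _ ≤ _ := by
        gcongr
        have h := sq_sum_le_card_mul_sum_sq (s := Finset.univ) (f := fun k => |v k|)
        simpa only [sq_abs, Finset.card_univ] using h


/-- Lemma 12 of the paper: with `γ = (1+√2)²` there are constants `C₁, C₂ > 0`
such that for all `N` and all `M ≥ C₁ N² γ^N`, the finite-node EDMD Gram matrix
`Ĥ_N^{(M)}` (monomial observables, equidistant nodes) is invertible with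
`‖(Ĥ_N^{(M)})⁻¹‖₂ ≤ C₂ γ^N`. -/
theorem finite_node_gram_matrix_inverse_bound :
    ∃ C₁ > (0 : ℝ), ∃ C₂ > (0 : ℝ), ∀ N M : ℕ, ∀ δ : ℝ,
      C₁ * N ^ 2 * ((1 + Real.sqrt 2) ^ 2) ^ N ≤ M → 0 ≤ δ → δ ≤ 2 / M →
      IsUnit (Matrix.of fun k l : Fin N =>
          (1 / M * ∑ m ∈ Finset.range M,
            (-1 + δ + 2 * m / M) ^ ((k : ℕ) + (l : ℕ)) : ℝ)) ∧
      ∀ v : EuclideanSpace ℝ (Fin N),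
        ‖Matrix.toEuclideanLin
            (Matrix.of fun k l : Fin N =>
              (1 / M * ∑ m ∈ Finset.range M,
                (-1 + δ + 2 * m / M) ^ ((k : ℕ) + (l : ℕ)) : ℝ))⁻¹ v‖ ≤
          C₂ * ((1 + Real.sqrt 2) ^ 2) ^ N * ‖v‖ := by
  refine ⟨16, by norm_num, 2, by norm_num, fun N M δ hNM h0 h1 => ?_⟩
  rcases Nat.eq_zero_or_pos N with rfl | hN
  · refine ⟨isUnit_of_subsingleton _, fun v => ?_⟩
    rw [Subsingleton.elim v 0]
    simp
  set γ : ℝ := ((1 + Real.sqrt 2) ^ 2) ^ N with hγ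
  have hγ0 : 0 < γ := by positivity
  have hN' : (0 : ℝ) < N := by exact_mod_cast hN
  have hM' : (0 : ℝ) < M := lt_of_lt_of_le (by positivity) hNM
  have hM : 0 < M := by exact_mod_cast hM'
  have hinv : (1 / (2 * γ))⁻¹ = 2 * γ := by rw [one_div, inv_inv]
  rw [← hinv]
  refine isUnit_and_norm_inv_le_of_coercive _ _ (by positivity) fun v => ?_
  have hmain := pi_div_four_mul_sum_sq_le v
  have hS : 0 ≤ ∑ k, v k ^ 2 := Finset.sum_nonneg fun k _ => sq_nonneg _
  have herr := abs_sum_mul_mul_le v (fun k l : Fin N =>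
    1 / M * ∑ m ∈ Finset.range M, (-1 + δ + 2 * m / M) ^ ((k : ℕ) + (l : ℕ)) -
      1 / 2 * ∫ x in (-1 : ℝ)..1, x ^ ((k : ℕ) + (l : ℕ))) (4 * N / M) (fun k l => by
      refine (abs_riemann_sum_pow_sub_integral_le M _ hM δ h0 h1).trans ?_
      have h2 : (((k : ℕ) + (l : ℕ) : ℕ) : ℝ) ≤ 2 * N := by
        exact_mod_cast (by omega : (k : ℕ) + (l : ℕ) ≤ 2 * N)
      exact div_le_div_of_nonneg_right (by linarith) hM'.le) (by positivity)
  simp only [mul_sub, Finset.sum_sub_distrib, Fintype.card_fin] at herr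
  have herr' := (abs_le.mp herr).1
  rw [← hγ] at hmain
  simp only [Matrix.of_apply]
  set S := ∑ k, v k ^ 2
  set Q := ∑ k, ∑ l, v k * v l * (1 / 2 * ∫ x in (-1 : ℝ)..1, x ^ ((k : ℕ) + (l : ℕ)))
  have hQ : 3 / 4 * S / γ ≤ Q := by
    rw [div_le_iff₀ hγ0]
    nlinarith [Real.pi_gt_three]
  have hsmall : 4 * N / M * (N * S) ≤ 1 / 4 * S / γ := by
    rw [le_div_iff₀ hγ0, show 4 * N / M * (N * S) * γ = 4 * N ^ 2 * γ * S / M by ring,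
      div_le_iff₀ hM']
    nlinarith [mul_le_mul_of_nonneg_right hNM hS]
  have hid : 1 / (2 * γ) * S = 3 / 4 * S / γ - 1 / 4 * S / γ := by
    field_simp
    ring
  rw [hid]
  linarith
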